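/- arXiv:1711.00584 — 4 statements merged into one kernel-verified Lean document; each statement's English description precedes it below -/
import Mathlib

section
/- Let Γ be smooth symmetric connection coefficients on ℝ⁴ and let F : ℝ² → ℝ⁴, written F(τ,λ), be a smooth one-parameter family of geodesics, i.e. ∂²_λF^μ + Γ^μ_{αβ}(F)·∂_λF^α·∂_λF^β = 0 for all (τ,λ). Set γ(λ) := F(0,λ), p(λ) := ∂_λF(0,λ) and ξ(λ) := ∂_τF(0,λ). Then ξ satisfies the geodesic deviation (Jacobi) equation along γ: for every λ and every μ ∈ Fin 4, (∇_λ∇_λξ)^μ(λ) = R^μ_{ναβ}(γ(λ))·p^ν(λ)·p^α(λ)·ξ^β(λ), where ∇_λ is the covariant derivative along γ and R is the curvature tensor of Γ. -/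
open scoped BigOperators

/-- Points of the spacetime manifold ℝ⁴, in coordinates. -/
abbrev Pt : Type := Fin 4 → ℝ

/-- Connection coefficients `Γ^μ_{αβ}` on ℝ⁴. -/
abbrev Conn : Type := Pt → Fin 4 → Fin 4 → Fin 4 → ℝ

/-- Coordinate partial derivative `∂_α f` of a scalar field on ℝ⁴. -/
noncomputable def pd (f : Pt → ℝ) (α : Fin 4) (x : Pt) : ℝ :=
  fderiv ℝ f x (Pi.single α 1)

/-- Curvature tensor `R^μ_{ναβ} = ∂_αΓ^μ_{βν} − ∂_βΓ^μ_{αν} + Γ^μ_{ακ}Γ^κ_{βν} − Γ^μ_{βκ}Γ^κ_{αν}`. -/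
noncomputable def curv (Γ : Conn) (x : Pt) (μ ν α β : Fin 4) : ℝ :=
  pd (fun y => Γ y μ β ν) α x - pd (fun y => Γ y μ α ν) β x
    + ∑ κ, Γ x μ α κ * Γ x κ β ν - ∑ κ, Γ x μ β κ * Γ x κ α ν

/-- `∂_λ F`, the partial derivative of a two-parameter family `F(τ,λ)` in `λ`. -/
noncomputable def dlam (F : ℝ → ℝ → Pt) : ℝ → ℝ → Pt :=
  fun τ l μ => deriv (fun s => F τ s μ) l

/-- `∂_τ F`, the partial derivative of a two-parameter family `F(τ,λ)` in `τ`. -/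
noncomputable def dtau (F : ℝ → ℝ → Pt) : ℝ → ℝ → Pt :=
  fun τ l μ => deriv (fun s => F s l μ) τ

/-- Covariant derivative `∇_λ V` of a vector field `V` along a single curve `x`:
`(∇_λ V)^μ = ∂_λ V^μ + Γ^μ_{αβ}(x) x'^α V^β`. -/
noncomputable def covC (Γ : Conn) (x V : ℝ → Pt) : ℝ → Pt :=
  fun l μ => deriv (fun s => V s μ) l
    + ∑ α, ∑ β, Γ (x l) μ α β * deriv (fun s => x s α) l * V l β

/-- The connection coefficients are smooth. -/
def SmoothConn (Γ : Conn) : Prop := ∀ μ α β, ContDiff ℝ (⊤ : ℕ∞) fun x => Γ x μ α β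

/-- The connection coefficients are symmetric in the lower indices. -/
def SymmConn (Γ : Conn) : Prop := ∀ x μ α β, Γ x μ α β = Γ x μ β α

/-- A two-parameter family `F(τ,λ)` is smooth (jointly, in each component). -/
def SmoothFam (F : ℝ → ℝ → Pt) : Prop := ∀ μ, ContDiff ℝ (⊤ : ℕ∞) fun q : ℝ × ℝ => F q.1 q.2 μ

/-- The partial derivative in the second variable, as a directional derivative. -/
theorem hasDerivAt_snd_of_uncurry {f : ℝ → ℝ → ℝ}
    (hf : Differentiable ℝ fun q : ℝ × ℝ => f q.1 q.2) (t l : ℝ) :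
    HasDerivAt (fun s => f t s) (fderiv ℝ (fun q : ℝ × ℝ => f q.1 q.2) (t, l) (0, 1)) l :=
  (hf (t, l)).hasFDerivAt.comp_hasDerivAt (f := fun s : ℝ => (t, s)) l
    ((hasDerivAt_const l t).prodMk (hasDerivAt_id l))

/-- The partial derivative in the first variable, as a directional derivative. -/
theorem hasDerivAt_fst_of_uncurry {f : ℝ → ℝ → ℝ}
    (hf : Differentiable ℝ fun q : ℝ × ℝ => f q.1 q.2) (t l : ℝ) :
    HasDerivAt (fun s => f s l) (fderiv ℝ (fun q : ℝ × ℝ => f q.1 q.2) (t, l) (1, 0)) t :=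
  (hf (t, l)).hasFDerivAt.comp_hasDerivAt (f := fun s : ℝ => (s, l)) t
    ((hasDerivAt_id t).prodMk (hasDerivAt_const t l))

theorem contDiff_deriv_snd {f : ℝ → ℝ → ℝ}
    (hf : ContDiff ℝ (⊤ : ℕ∞) fun q : ℝ × ℝ => f q.1 q.2) :
    ContDiff ℝ (⊤ : ℕ∞) fun q : ℝ × ℝ => deriv (fun s => f q.1 s) q.2 := by
  have h : (fun q : ℝ × ℝ => deriv (fun s => f q.1 s) q.2)
      = fun q => fderiv ℝ (fun q : ℝ × ℝ => f q.1 q.2) q (0, 1) :=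
    funext fun q => (hasDerivAt_snd_of_uncurry (hf.differentiable (by simp)) q.1 q.2).deriv
  rw [h]
  exact (hf.fderiv_right (m := (⊤ : ℕ∞)) (by simp)).clm_apply contDiff_const

theorem contDiff_deriv_fst {f : ℝ → ℝ → ℝ}
    (hf : ContDiff ℝ (⊤ : ℕ∞) fun q : ℝ × ℝ => f q.1 q.2) :
    ContDiff ℝ (⊤ : ℕ∞) fun q : ℝ × ℝ => deriv (fun s => f s q.2) q.1 := by
  have h : (fun q : ℝ × ℝ => deriv (fun s => f s q.2) q.1)
      = fun q => fderiv ℝ (fun q : ℝ × ℝ => f q.1 q.2) q (1, 0) :=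
    funext fun q => (hasDerivAt_fst_of_uncurry (hf.differentiable (by simp)) q.1 q.2).deriv
  rw [h]
  exact (hf.fderiv_right (m := (⊤ : ℕ∞)) (by simp)).clm_apply contDiff_const

/-- Mixed partial derivatives of a smooth function of two real variables commute. -/
theorem deriv_deriv_comm {f : ℝ → ℝ → ℝ}
    (hf : ContDiff ℝ (⊤ : ℕ∞) fun q : ℝ × ℝ => f q.1 q.2) (t l : ℝ) :
    deriv (fun s => deriv (fun r => f r s) t) l = deriv (fun r => deriv (fun s => f r s) l) t := by
  have hd := hf.differentiable (by simp)
  have hdd : Differentiable ℝ (fderiv ℝ fun q : ℝ × ℝ => f q.1 q.2) :=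
    (hf.fderiv_right (m := (⊤ : ℕ∞)) (by simp)).differentiable (by simp)
  have hsymm : IsSymmSndFDerivAt ℝ (fun q : ℝ × ℝ => f q.1 q.2) (t, l) :=
    hf.contDiffAt.isSymmSndFDerivAt (by
      rw [minSmoothness_of_isRCLikeNormedField]
      exact WithTop.coe_le_coe.2 (le_top : (2 : ℕ∞) ≤ ⊤))
  have h₁ : HasDerivAt (fun s => deriv (fun r => f r s) t)
      (fderiv ℝ (fderiv ℝ fun q : ℝ × ℝ => f q.1 q.2) (t, l) (0, 1) (1, 0)) l := by
    rw [funext fun s => (hasDerivAt_fst_of_uncurry hd t s).deriv]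
    have h := (hdd (t, l)).hasFDerivAt.comp_hasDerivAt (f := fun s : ℝ => (t, s)) l
      ((hasDerivAt_const l t).prodMk (hasDerivAt_id l))
    simpa using h.clm_apply (hasDerivAt_const l ((1, 0) : ℝ × ℝ))
  have h₂ : HasDerivAt (fun r => deriv (fun s => f r s) l)
      (fderiv ℝ (fderiv ℝ fun q : ℝ × ℝ => f q.1 q.2) (t, l) (1, 0) (0, 1)) t := by
    rw [funext fun r => (hasDerivAt_snd_of_uncurry hd r l).deriv]
    have h := (hdd (t, l)).hasFDerivAt.comp_hasDerivAt (f := fun s : ℝ => (s, l)) t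
      ((hasDerivAt_id t).prodMk (hasDerivAt_const t l))
    simpa using h.clm_apply (hasDerivAt_const t ((0, 1) : ℝ × ℝ))
  rw [h₁.deriv, h₂.deriv, hsymm.eq]

/-- The chain rule along a curve in coordinates. -/
theorem hasDerivAt_comp_curve {f : Pt → ℝ} {x : ℝ → Pt} {v : Pt} {s : ℝ}
    (hf : DifferentiableAt ℝ f (x s)) (hx : ∀ κ, HasDerivAt (fun r => x r κ) (v κ) s) :
    HasDerivAt (fun r => f (x r)) (∑ κ, pd f κ (x s) * v κ) s := by
  refine (hf.hasFDerivAt.comp_hasDerivAt s (hasDerivAt_pi.2 hx)).congr_deriv ?_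
  conv_lhs => rw [pi_eq_sum_univ' v, map_sum]
  refine Finset.sum_congr rfl fun κ _ => ?_
  rw [map_smul, smul_eq_mul, mul_comm, pd]

/-- The product rule for the term `Γ^μ_{αβ} u^α w^β` along a curve. -/
theorem hasDerivAt_christoffel_contraction {Γ : Conn} (hΓ : SmoothConn Γ) {x u w : ℝ → Pt}
    {v u' w' : Pt} {s : ℝ} (hx : ∀ κ, HasDerivAt (fun r => x r κ) (v κ) s)
    (hu : ∀ κ, HasDerivAt (fun r => u r κ) (u' κ) s)
    (hw : ∀ κ, HasDerivAt (fun r => w r κ) (w' κ) s) (μ : Fin 4) :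
    HasDerivAt (fun r => ∑ α, ∑ β, Γ (x r) μ α β * u r α * w r β)
      (∑ α, ∑ β, (((∑ κ, pd (fun y => Γ y μ α β) κ (x s) * v κ) * u s α
        + Γ (x s) μ α β * u' α) * w s β + Γ (x s) μ α β * u s α * w' β)) s :=
  HasDerivAt.fun_sum fun α _ => HasDerivAt.fun_sum fun β _ =>
    ((hasDerivAt_comp_curve ((hΓ μ α β).differentiable (by simp) _) hx).fun_mul (hu α)).fun_mul
      (hw β)

/-- The pointwise algebra behind the Jacobi equation: `G` and `D` stand for the connection
coefficients and their partial derivatives, `q` for `∂_τ p = ∂_λ ξ`. -/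
theorem jacobi_algebra {ι : Type*} [Fintype ι] (G : ι → ι → ι → ℝ) (D : ι → ι → ι → ι → ℝ)
    (hG : ∀ μ α β, G μ α β = G μ β α) (hD : ∀ μ α β κ, D μ α β κ = D μ β α κ)
    (p ξ q : ι → ℝ) (μ : ι) :
    -(∑ α, ∑ β, (((∑ κ, D μ α β κ * ξ κ) * p α + G μ α β * q α) * p β + G μ α β * p α * q β))
      + (∑ α, ∑ β, (((∑ κ, D μ α β κ * p κ) * p α
          + G μ α β * -(∑ κ, ∑ σ, G α κ σ * p κ * p σ)) * ξ β + G μ α β * p α * q β))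
      + (∑ α, ∑ β, G μ α β * p α * (q β + ∑ κ, ∑ σ, G β κ σ * p κ * ξ σ))
    = ∑ ν, ∑ α, ∑ β, (D μ β ν α - D μ α ν β + ∑ κ, G μ α κ * G κ β ν
        - ∑ κ, G μ β κ * G κ α ν) * p ν * p α * ξ β := by
  have hq : ∑ α, ∑ β, G μ α β * q α * p β = ∑ α, ∑ β, G μ α β * p α * q β := by
    rw [Finset.sum_comm]
    refine Finset.sum_congr rfl fun α _ => Finset.sum_congr rfl fun β _ => ?_
    rw [hG μ β α]; ring
  have h₁ : ∑ α, ∑ β, (∑ κ, D μ α β κ * ξ κ) * p α * p β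
      = ∑ ν, ∑ α, ∑ β, D μ α ν β * p ν * p α * ξ β := by
    rw [Finset.sum_comm]
    refine Finset.sum_congr rfl fun ν _ => Finset.sum_congr rfl fun α _ => ?_
    simp only [Finset.sum_mul]
    exact Finset.sum_congr rfl fun β _ => by ring
  have h₂ : ∑ α, ∑ β, (∑ κ, D μ α β κ * p κ) * p α * ξ β
      = ∑ ν, ∑ α, ∑ β, D μ β ν α * p ν * p α * ξ β := by
    refine Finset.sum_congr rfl fun ν _ => ?_
    rw [Finset.sum_comm]
    refine Finset.sum_congr rfl fun β _ => ?_
    simp only [Finset.sum_mul]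
    exact Finset.sum_congr rfl fun α _ => by rw [hD μ ν β α]; ring
  have h₃ : ∑ α, ∑ β, G μ α β * (∑ κ, ∑ σ, G α κ σ * p κ * p σ) * ξ β
      = ∑ ν, ∑ α, ∑ β, (∑ κ, G μ β κ * G κ α ν) * p ν * p α * ξ β := by
    simp only [Finset.mul_sum, Finset.sum_mul]
    rw [Finset.sum_comm, Finset.sum_congr rfl fun β _ => Finset.sum_comm, Finset.sum_comm]
    refine Finset.sum_congr rfl fun ν _ => ?_
    rw [Finset.sum_congr rfl fun β _ => Finset.sum_comm, Finset.sum_comm]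
    refine Finset.sum_congr rfl fun α _ => Finset.sum_congr rfl fun β _ =>
      Finset.sum_congr rfl fun κ _ => ?_
    rw [hG μ κ β, hG κ ν α]; ring
  have h₄ : ∑ α, ∑ β, G μ α β * p α * (∑ κ, ∑ σ, G β κ σ * p κ * ξ σ)
      = ∑ ν, ∑ α, ∑ β, (∑ κ, G μ α κ * G κ β ν) * p ν * p α * ξ β := by
    simp only [Finset.mul_sum, Finset.sum_mul]
    rw [Finset.sum_congr rfl fun α _ => Finset.sum_comm, Finset.sum_comm]
    refine Finset.sum_congr rfl fun ν _ => Finset.sum_congr rfl fun α _ => ?_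
    rw [Finset.sum_comm]
    refine Finset.sum_congr rfl fun β _ => Finset.sum_congr rfl fun κ _ => ?_
    rw [hG κ β ν]; ring
  simp only [add_mul, sub_mul, mul_add, mul_neg, neg_mul, Finset.sum_add_distrib,
    Finset.sum_sub_distrib, Finset.sum_neg_distrib] at *
  rw [h₁, h₂, h₃, h₄, hq]
  ring

/-- for a smooth one-parameter family of geodesics `F(τ,λ)` of a smooth
symmetric connection `Γ`, the deviation vector `ξ = ∂_τ F(0,·)` satisfies the geodesic
deviation (Jacobi) equation along `γ = F(0,·)`:
`(∇_λ∇_λξ)^μ = R^μ_{ναβ}(γ) p^ν p^α ξ^β` with `p = ∂_λF(0,·)`. -/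
theorem geodesic_deviation_equation
    (Γ : Conn) (hΓs : SmoothConn Γ) (hΓsym : SymmConn Γ)
    (F : ℝ → ℝ → Pt) (hF : SmoothFam F)
    (hgeo : ∀ τ l μ, deriv (fun s => dlam F τ s μ) l
        + ∑ α, ∑ β, Γ (F τ l) μ α β * dlam F τ l α * dlam F τ l β = 0) :
    ∀ l μ,
      covC Γ (F 0) (covC Γ (F 0) (dtau F 0)) l μ
        = ∑ ν, ∑ α, ∑ β,
            curv Γ (F 0 l) μ ν α β * dlam F 0 l ν * dlam F 0 l α * dtau F 0 l β := by
  intro l μ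
  have hp : SmoothFam (dlam F) := fun ν => contDiff_deriv_snd (f := fun t s => F t s ν) (hF ν)
  have hξ : SmoothFam (dtau F) := fun ν => contDiff_deriv_fst (f := fun t s => F t s ν) (hF ν)
  have dsnd : ∀ {V : ℝ → ℝ → Pt}, SmoothFam V → ∀ s κ,
      HasDerivAt (fun r => V 0 r κ) (dlam V 0 s κ) s := fun {V} hV s κ =>
    (hasDerivAt_snd_of_uncurry (f := fun t s => V t s κ) ((hV κ).differentiable (by simp)) 0
      s).differentiableAt.hasDerivAt
  have dfst : ∀ {V : ℝ → ℝ → Pt}, SmoothFam V → ∀ s κ,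
      HasDerivAt (fun r => V r s κ) (dtau V 0 s κ) 0 := fun {V} hV s κ =>
    (hasDerivAt_fst_of_uncurry (f := fun t s => V t s κ) ((hV κ).differentiable (by simp)) 0
      s).differentiableAt.hasDerivAt
  have hswap : dlam (dtau F) = dtau (dlam F) := by
    funext t s κ
    exact deriv_deriv_comm (f := fun t s => F t s κ) (hF κ) t s
  have hacc : dlam (dlam F)
      = fun t s κ => -∑ α, ∑ β, Γ (F t s) κ α β * dlam F t s α * dlam F t s β := by
    funext t s κ
    exact eq_neg_of_add_eq_zero_left (hgeo t s κ)
  have hcov : covC Γ (F 0) (dtau F 0) = fun s κ => dtau (dlam F) 0 s κ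
      + ∑ α, ∑ β, Γ (F 0 s) κ α β * dlam F 0 s α * dtau F 0 s β := by
    rw [← hswap]; rfl
  have hjerk : dlam (dtau (dlam F)) 0 l μ = -(∑ α, ∑ β,
      (((∑ κ, pd (fun y => Γ y μ α β) κ (F 0 l) * dtau F 0 l κ) * dlam F 0 l α
        + Γ (F 0 l) μ α β * dtau (dlam F) 0 l α) * dlam F 0 l β
        + Γ (F 0 l) μ α β * dlam F 0 l α * dtau (dlam F) 0 l β)) := by
    have h : dlam (dtau (dlam F)) 0 l μ = dtau (dlam (dlam F)) 0 l μ :=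
      deriv_deriv_comm (f := fun t s => dlam F t s μ) (hp μ) 0 l
    rw [h, hacc]
    exact (hasDerivAt_christoffel_contraction hΓs (dfst hF l) (dfst hp l) (dfst hp l) μ).neg.deriv
  have hp' : SmoothFam (dtau (dlam F)) := fun ν =>
    contDiff_deriv_fst (f := fun t s => dlam F t s ν) (hp ν)
  have hderiv := ((dsnd hp' l μ).add (hasDerivAt_christoffel_contraction hΓs (dsnd hF l)
    (dsnd hp l) (dsnd hξ l) μ)).deriv
  have halg := jacobi_algebra (Γ (F 0 l)) (fun m α β κ => pd (fun y => Γ y m α β) κ (F 0 l))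
    (hΓsym _) (fun m α β κ => by simp only [hΓsym _ m α β])
    (dlam F 0 l) (dtau F 0 l) (dtau (dlam F) 0 l) μ
  change deriv (fun s => covC Γ (F 0) (dtau F 0) s μ) l
    + ∑ α, ∑ β, Γ (F 0 l) μ α β * dlam F 0 l α * covC Γ (F 0) (dtau F 0) l β = _
  rw [hcov]
  refine (congrArg (· + _) hderiv).trans ?_
  rw [hjerk, hswap, hacc]
  exact halg
end

section
/- Let u ∈ ℝ⁴ with η(u,u) = −1, let p ∈ ℝ⁴ be nonzero and null (η(p,p) = 0), and let r ∈ ℝ⁴ be the unique vector with η(r,r) = 1, η(r,u) = 0 and p = η(p,u)·(−u + r). Then for every ξ ∈ ℝ⁴ with η(ξ,p) = 0 there exists a unique D ∈ ℝ such that ξ̃ := ξ + D·p satisfies η(ξ̃,u) = 0; and this ξ̃ moreover satisfies η(ξ̃,r) = 0, i.e. the simultaneous representative of an orthogonally displaced photon lies in the observer's screen space orthogonal to both u and the direction of propagation r. -/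
/-- The Minkowski bilinear form on ℝ⁴: `η(x,y) = −x₀y₀ + x₁y₁ + x₂y₂ + x₃y₃`. -/
def eta (x y : Fin 4 → ℝ) : ℝ :=
  -(x 0 * y 0) + x 1 * y 1 + x 2 * y 2 + x 3 * y 3

theorem eta_add_left (x y z : Fin 4 → ℝ) : eta (x + y) z = eta x z + eta y z := by
  simp only [eta, Pi.add_apply]
  ring

theorem eta_smul_left (a : ℝ) (x y : Fin 4 → ℝ) : eta (a • x) y = a * eta x y := by
  simp only [eta, Pi.smul_apply, smul_eq_mul]
  ring

theorem eta_neg_left (x y : Fin 4 → ℝ) : eta (-x) y = -eta x y := by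
  simp only [eta, Pi.neg_apply]
  ring

theorem eta_comm (x y : Fin 4 → ℝ) : eta x y = eta y x := by
  simp only [eta]
  ring

/-- let `u` be a normalized observer 4-velocity, `p` a nonzero null
vector and `r` the direction vector with `η(r,r) = 1`, `η(r,u) = 0` and
`p = η(p,u)·(−u + r)`. Then every `ξ` orthogonal to `p` has a unique simultaneous
representative `ξ̃ = ξ + D·p` with `η(ξ̃,u) = 0`, and this representative also
satisfies `η(ξ̃,r) = 0` (it lies in the observer's screen space). -/
theorem simultaneous_representative_in_screen_space
    (u p r : Fin 4 → ℝ) (hu : eta u u = -1) (hp : p ≠ 0) (hnull : eta p p = 0)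
    (hr1 : eta r r = 1) (hr2 : eta r u = 0) (hr3 : p = eta p u • (-u + r)) :
    ∀ ξ : Fin 4 → ℝ, eta ξ p = 0 →
      (∃! D : ℝ, eta (ξ + D • p) u = 0) ∧
      ∀ D : ℝ, eta (ξ + D • p) u = 0 → eta (ξ + D • p) r = 0 := by
  have ha : eta p u ≠ 0 := fun h => hp (by rw [hr3, h, zero_smul])
  have hpr : eta p r = eta p u := by
    conv_lhs => rw [hr3]
    rw [eta_smul_left, eta_add_left, eta_neg_left, hr1, eta_comm u r, hr2]
    ring
  intro ξ hξ
  have hξr : eta ξ r = eta ξ u := by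
    rw [eta_comm, hr3, eta_smul_left, eta_add_left, eta_neg_left, eta_comm u ξ,
      eta_comm r ξ] at hξ
    linarith [(mul_eq_zero.mp hξ).resolve_left ha]
  simp only [eta_add_left, eta_smul_left, hpr, hξr]
  refine ⟨⟨-eta ξ u / eta p u, ?_, fun D hD => ?_⟩, fun D hD => hD⟩
  · field_simp
    ring
  · rw [eq_div_iff ha]
    linarith
end

section
/- Let u_O, u_E ∈ ℝ⁴, C ∈ ℝ, and λ_O, λ_E ∈ ℝ. Suppose X : ℝ → ℝ⁴ (the observation time vector along the null geodesic) is twice differentiable and satisfies X''(λ) = K(λ)(X(λ)) for all λ, together with the boundary conditions X(λ_O) = u_O and X(λ_E) = C·u_E, and suppose η(X'(λ₀), p) = 0 for at least one λ₀ ∈ ℝ (the null-preservation condition). Then C·η(p, u_E) = η(p, u_O); in particular, if η(p, u_E) ≠ 0 then C = η(p, u_O)/η(p, u_E) = (1 + z)⁻¹, where the redshift is defined by 1 + z := η(p, u_E)/η(p, u_O). -/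
theorem eta_smul_right (x y : Fin 4 → ℝ) (c : ℝ) : eta x (c • y) = c * eta x y := by
  simp only [eta, Pi.smul_apply, smul_eq_mul]
  ring

theorem HasDerivAt.eta_left {f : ℝ → Fin 4 → ℝ} {f' : Fin 4 → ℝ} {l : ℝ}
    (hf : HasDerivAt f f' l) (p : Fin 4 → ℝ) :
    HasDerivAt (fun t => eta (f t) p) (eta f' p) l := by
  have h := hasDerivAt_pi.1 hf
  exact ((((h 0).mul_const (p 0)).fun_neg.fun_add ((h 1).mul_const (p 1))).fun_add
    ((h 2).mul_const (p 2))).fun_add ((h 3).mul_const (p 3))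

/-- If `η(f', p)` vanishes identically, then `η(f, p)` is constant. -/
theorem eta_eq_of_eta_deriv_eq_zero {f : ℝ → Fin 4 → ℝ} {p : Fin 4 → ℝ}
    (hf : Differentiable ℝ f) (h : ∀ l, eta (deriv f l) p = 0) (a b : ℝ) :
    eta (f a) p = eta (f b) p := by
  have hd : ∀ l, HasDerivAt (fun t => eta (f t) p) (eta (deriv f l) p) l :=
    fun l => (hf l).hasDerivAt.eta_left p
  exact is_const_of_deriv_eq_zero (fun l => (hd l).differentiableAt)
    (fun l => (hd l).deriv.trans (h l)) a b

/-- let `X` (the observation time vector) solve `X'' = K(λ)(X)` in a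
parallel frame along a null geodesic with constant tangent `p`, where
`η(K(λ)x, p) = 0`, with boundary values `X(λ_O) = u_O`, `X(λ_E) = C·u_E` and the
null-preservation condition `η(X'(λ₀), p) = 0` at some `λ₀`. Then
`C·η(p,u_E) = η(p,u_O)`; in particular if `η(p,u_E) ≠ 0` then
`C = η(p,u_O)/η(p,u_E) = (1+z)⁻¹` with `1 + z := η(p,u_E)/η(p,u_O)`. -/
theorem observation_time_vector_normalization
    (p : Fin 4 → ℝ) (K : ℝ → ((Fin 4 → ℝ) →ₗ[ℝ] (Fin 4 → ℝ)))
    (hKcont : ∀ v, Continuous fun l => K l v)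
    (hKp : ∀ l x, eta (K l x) p = 0)
    (uO uE : Fin 4 → ℝ) (C lO lE : ℝ)
    (X : ℝ → Fin 4 → ℝ)
    (hX : Differentiable ℝ X) (hX' : Differentiable ℝ (deriv X))
    (hGDE : ∀ l, deriv (deriv X) l = K l (X l))
    (hbO : X lO = uO) (hbE : X lE = C • uE)
    (hnullpres : ∃ l₀ : ℝ, eta (deriv X l₀) p = 0) :
    C * eta p uE = eta p uO ∧
    (eta p uE ≠ 0 →
      C = eta p uO / eta p uE ∧ C = (eta p uE / eta p uO)⁻¹) := by
  obtain ⟨l₀, hl₀⟩ := hnullpres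
  have hX'p : ∀ l, eta (deriv X l) p = 0 := fun l =>
    (eta_eq_of_eta_deriv_eq_zero hX' (fun t => by rw [hGDE, hKp]) l l₀).trans hl₀
  have key : C * eta p uE = eta p uO := by
    rw [← eta_smul_right, ← hbE, ← hbO, eta_comm p, eta_comm p]
    exact eta_eq_of_eta_deriv_eq_zero hX hX'p lE lO
  refine ⟨key, fun hE => ?_⟩
  have hC : C = eta p uO / eta p uE := eq_div_of_mul_eq hE key
  exact ⟨hC, by rw [inv_div, hC]⟩
end

section
/- Let Γ be smooth symmetric connection coefficients on ℝ⁴ and let g : ℝ⁴ → ℝ (indexed g_{μν}, symmetric: g_{μν} = g_{νμ}) be a smooth metric field compatible with Γ: ∂_αg_{μν} = Γ^κ_{αμ}·g_{κν} + Γ^κ_{αν}·g_{μκ} for all indices. Let F : ℝ² → ℝ⁴, with parameters (τ,λ), be a smooth family of geodesics (∂²_λF^μ + Γ^μ_{αβ}(F)·∂_λF^α·∂_λF^β = 0 for all (τ,λ)); set p := ∂_λF and X := ∂_τF. Let û : ℝ² → ℝ⁴ be smooth with (∇_λû)^μ = 0 for all (τ,λ) (a family of parallel-transported 4-velocities). Then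 for all (τ,λ): ∂_λ[ g_{μν}(F)·p^μ·(∇_τû)^ν ] = g_{μκ}(F)·p^μ·R^κ_{ναβ}(F)·û^ν·p^α·X^β. -/
open scoped BigOperators

/-- Covariant `λ`-derivative of a vector field `V(τ,λ)` along `F`:
`(∇_λV)^μ = ∂_λV^μ + Γ^μ_{αβ}(F) ∂_λF^α V^β`. -/
noncomputable def covLam (Γ : Conn) (F V : ℝ → ℝ → Pt) : ℝ → ℝ → Pt :=
  fun τ l μ => deriv (fun s => V τ s μ) l
    + ∑ α, ∑ β, Γ (F τ l) μ α β * dlam F τ l α * V τ l β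

/-- Covariant `τ`-derivative of a vector field `V(τ,λ)` along `F`:
`(∇_τV)^μ = ∂_τV^μ + Γ^μ_{αβ}(F) ∂_τF^α V^β`. -/
noncomputable def covTau (Γ : Conn) (F V : ℝ → ℝ → Pt) : ℝ → ℝ → Pt :=
  fun τ l μ => deriv (fun s => V s l μ) τ
    + ∑ α, ∑ β, Γ (F τ l) μ α β * dtau F τ l α * V τ l β

/-- A metric field `g_{μν}` on ℝ⁴. -/
abbrev Metric : Type := Pt → Fin 4 → Fin 4 → ℝ

/-- Chain rule along a curve, in coordinates. -/
theorem pd_chain {f : Pt → ℝ} (hf : Differentiable ℝ f) {c : ℝ → Pt} {v : Pt} {l : ℝ}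
    (hc : ∀ α, HasDerivAt (fun s => c s α) (v α) l) :
    HasDerivAt (fun s => f (c s)) (∑ α, pd f α (c l) * v α) l := by
  have h := (hf (c l)).hasFDerivAt.comp_hasDerivAt l (hasDerivAt_pi.2 hc)
  have hv : fderiv ℝ f (c l) v = ∑ α, pd f α (c l) * v α := by
    conv_lhs => rw [pi_eq_sum_univ' v]
    simp [pd, map_sum, mul_comm]
  rw [← hv]
  exact h

/-- Slice derivative in the second variable. -/
theorem hasDerivAt_slice_snd {f : ℝ × ℝ → ℝ} {q : ℝ × ℝ} (hf : DifferentiableAt ℝ f q) :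
    HasDerivAt (fun s => f (q.1, s)) (fderiv ℝ f q (0, 1)) q.2 :=
  hf.hasFDerivAt.comp_hasDerivAt q.2 ((hasDerivAt_const q.2 q.1).prodMk (hasDerivAt_id q.2))

/-- Slice derivative in the first variable. -/
theorem hasDerivAt_slice_fst {f : ℝ × ℝ → ℝ} {q : ℝ × ℝ} (hf : DifferentiableAt ℝ f q) :
    HasDerivAt (fun s => f (s, q.2)) (fderiv ℝ f q (1, 0)) q.1 :=
  hf.hasFDerivAt.comp_hasDerivAt q.1 ((hasDerivAt_id q.1).prodMk (hasDerivAt_const q.1 q.2))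

theorem differentiable_fderiv_apply {f : ℝ × ℝ → ℝ} (hf : ContDiff ℝ (⊤ : ℕ∞) f) (v : ℝ × ℝ) :
    Differentiable ℝ fun q => fderiv ℝ f q v :=
  ((hf.fderiv_right (m := (⊤ : ℕ∞)) (by simp)).differentiable (by simp)).clm_apply
    (differentiable_const v)

/-- Equality of the mixed partial derivatives of a smooth function. -/
theorem fderiv_fderiv_apply_comm {f : ℝ × ℝ → ℝ} (hf : ContDiff ℝ (⊤ : ℕ∞) f) (q v w : ℝ × ℝ) :
    fderiv ℝ (fun r => fderiv ℝ f r v) q w = fderiv ℝ (fun r => fderiv ℝ f r w) q v := by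
  have hd : DifferentiableAt ℝ (fderiv ℝ f) q :=
    (hf.fderiv_right (m := (⊤ : ℕ∞)) (by simp)).differentiable (by simp) q
  have hs : IsSymmSndFDerivAt ℝ f q :=
    hf.contDiffAt.isSymmSndFDerivAt (by simpa using WithTop.coe_le_coe.2 (le_top (a := (2 : ℕ∞))))
  rw [fderiv_clm_apply hd (differentiableAt_const v),
    fderiv_clm_apply hd (differentiableAt_const w)]
  simpa using hs.eq w v

namespace SmoothFam

variable {F : ℝ → ℝ → Pt}

theorem dlam_eq (hF : SmoothFam F) (τ l : ℝ) (μ : Fin 4) :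
    dlam F τ l μ = fderiv ℝ (fun q : ℝ × ℝ => F q.1 q.2 μ) (τ, l) (0, 1) :=
  (hasDerivAt_slice_snd ((hF μ).differentiable (by simp) (τ, l))).deriv

theorem dtau_eq (hF : SmoothFam F) (τ l : ℝ) (μ : Fin 4) :
    dtau F τ l μ = fderiv ℝ (fun q : ℝ × ℝ => F q.1 q.2 μ) (τ, l) (1, 0) :=
  (hasDerivAt_slice_fst ((hF μ).differentiable (by simp) (τ, l))).deriv

theorem hasDerivAt_lam (hF : SmoothFam F) (τ l : ℝ) (μ : Fin 4) :
    HasDerivAt (fun s => F τ s μ) (dlam F τ l μ) l :=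
  (hasDerivAt_slice_snd ((hF μ).differentiable (by simp) (τ, l))).differentiableAt.hasDerivAt

theorem hasDerivAt_tau (hF : SmoothFam F) (τ l : ℝ) (μ : Fin 4) :
    HasDerivAt (fun s => F s l μ) (dtau F τ l μ) τ :=
  (hasDerivAt_slice_fst ((hF μ).differentiable (by simp) (τ, l))).differentiableAt.hasDerivAt

theorem hasDerivAt_dlam_lam (hF : SmoothFam F) (τ l : ℝ) (μ : Fin 4) :
    HasDerivAt (fun s => dlam F τ s μ) (deriv (fun s => dlam F τ s μ) l) l := by
  simp only [hF.dlam_eq]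
  exact (hasDerivAt_slice_snd
    (differentiable_fderiv_apply (hF μ) (0, 1) (τ, l))).differentiableAt.hasDerivAt

theorem hasDerivAt_dlam_tau (hF : SmoothFam F) (τ l : ℝ) (μ : Fin 4) :
    HasDerivAt (fun s => dlam F s l μ) (deriv (fun s => dlam F s l μ) τ) τ := by
  simp only [hF.dlam_eq]
  exact (hasDerivAt_slice_fst
    (differentiable_fderiv_apply (hF μ) (0, 1) (τ, l))).differentiableAt.hasDerivAt

/-- The `λ`-derivative of `∂_τ F` is the `τ`-derivative of `∂_λ F`. -/
theorem hasDerivAt_dtau_lam (hF : SmoothFam F) (τ l : ℝ) (μ : Fin 4) :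
    HasDerivAt (fun s => dtau F τ s μ) (deriv (fun s => dlam F s l μ) τ) l := by
  simp only [hF.dlam_eq, hF.dtau_eq]
  have h := (hasDerivAt_slice_fst (differentiable_fderiv_apply (hF μ) (0, 1) (τ, l))).deriv
  rw [h, ← fderiv_fderiv_apply_comm (hF μ)]
  exact hasDerivAt_slice_snd (differentiable_fderiv_apply (hF μ) (1, 0) (τ, l))

end SmoothFam

/-- The connection matrix `Γ^κ_{αν} v^α` in the direction `v`. -/
noncomputable def connForm (Γ : Conn) (x v : Pt) (κ ν : Fin 4) : ℝ :=
  ∑ α, Γ x κ α ν * v α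

theorem sum_connForm_mul (Γ : Conn) (x v w : Pt) (κ : Fin 4) :
    ∑ α, ∑ β, Γ x κ α β * v α * w β = ∑ β, connForm Γ x v κ β * w β := by
  simp only [connForm, Finset.sum_mul]
  exact Finset.sum_comm

theorem hasDerivAt_connForm {Γ : Conn} (hΓ : SmoothConn Γ) {c v : ℝ → Pt} {c' v' : Pt} {l : ℝ}
    (hc : ∀ α, HasDerivAt (fun s => c s α) (c' α) l)
    (hv : ∀ α, HasDerivAt (fun s => v s α) (v' α) l) (κ ν : Fin 4) :
    HasDerivAt (fun s => connForm Γ (c s) (v s) κ ν)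
      (∑ α, ((∑ γ, pd (fun y => Γ y κ α ν) γ (c l) * c' γ) * v l α + Γ (c l) κ α ν * v' α)) l :=
  HasDerivAt.fun_sum fun α _ =>
    (pd_chain ((hΓ κ α ν).differentiable (by simp)) hc).mul (hv α)

/-- Derivatives of the connection matrices along `v` and `w`, with common mixed derivative `m`,
combine to the curvature contracted with `v` and `w`. -/
theorem sum_curv_mul (Γ : Conn) (x v w m : Pt) (κ ν : Fin 4) :
    ∑ α, ∑ β, curv Γ x κ ν α β * v α * w β
      = ∑ α, ((∑ γ, pd (fun y => Γ y κ α ν) γ x * v γ) * w α + Γ x κ α ν * m α)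
        - ∑ α, ((∑ γ, pd (fun y => Γ y κ α ν) γ x * w γ) * v α + Γ x κ α ν * m α)
        + ∑ ρ, connForm Γ x v κ ρ * connForm Γ x w ρ ν
        - ∑ ρ, connForm Γ x w κ ρ * connForm Γ x v ρ ν := by
  simp only [curv, connForm, Fin.sum_univ_four]
  ring

/-- Commuting the covariant derivatives of a field parallel in `λ`: `∇_λ∇_τ u = R(p, X) u`. -/
theorem hasDerivAt_covTau {Γ : Conn} (hΓ : SmoothConn Γ) {F u : ℝ → ℝ → Pt}
    (hF : SmoothFam F) (hu : SmoothFam u) (hpar : ∀ τ l μ, covLam Γ F u τ l μ = 0)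
    (τ l : ℝ) (κ : Fin 4) :
    HasDerivAt (fun s => covTau Γ F u τ s κ)
      (∑ ν, (∑ α, ∑ β, curv Γ (F τ l) κ ν α β * dlam F τ l α * dtau F τ l β) * u τ l ν
        - ∑ β, connForm Γ (F τ l) (dlam F τ l) κ β * covTau Γ F u τ l β) l := by
  have hlam : ∀ t s μ, dlam u t s μ = -∑ β, connForm Γ (F t s) (dlam F t s) μ β * u t s β := by
    intro t s μ
    have h := hpar t s μ
    rw [covLam, sum_connForm_mul] at h
    exact eq_neg_of_add_eq_zero_left h
  have hA := hasDerivAt_connForm hΓ (hF.hasDerivAt_tau τ l) (hF.hasDerivAt_dlam_tau τ l)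
  have hB := hasDerivAt_connForm hΓ (hF.hasDerivAt_lam τ l) (hF.hasDerivAt_dtau_lam τ l)
  have hut := hu.hasDerivAt_dtau_lam τ l κ
  simp only [hlam] at hut
  rw [(HasDerivAt.fun_sum fun β _ =>
    (hA κ β).fun_mul (hu.hasDerivAt_tau τ l β)).fun_neg.deriv] at hut
  have hW := hut.fun_add
    (HasDerivAt.fun_sum fun β (_ : β ∈ Finset.univ) => (hB κ β).fun_mul (hu.hasDerivAt_lam τ l β))
  have hcov : ∀ s μ, covTau Γ F u τ s μ
      = dtau u τ s μ + ∑ β, connForm Γ (F τ s) (dtau F τ s) μ β * u τ s β := fun s μ => by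
    rw [covTau, sum_connForm_mul]; rfl
  simp only [hcov]
  refine hW.congr_deriv ?_
  simp only [sum_curv_mul Γ (F τ l) _ _ fun α => deriv (fun s => dlam F s l α) τ, hlam]
  generalize connForm Γ (F τ l) (dlam F τ l) = A
  generalize connForm Γ (F τ l) (dtau F τ l) = B
  simp only [Fin.sum_univ_four]
  ring

/-- let `g` be a smooth symmetric metric compatible with a smooth
symmetric connection `Γ`, let `F(τ,λ)` be a smooth family of geodesics with
`p = ∂_λF`, `X = ∂_τF`, and let `û` be a smooth family of parallel-transported
4-velocities (`(∇_λû)^μ = 0`). Then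
`∂_λ[g_{μν}(F) p^μ (∇_τû)^ν] = g_{μκ}(F) p^μ R^κ_{ναβ}(F) û^ν p^α X^β`. -/
theorem redshift_drift_integrand
    (Γ : Conn) (hΓs : SmoothConn Γ) (hΓsym : SymmConn Γ)
    (g : Metric)
    (hgs : ∀ μ ν, ContDiff ℝ (⊤ : ℕ∞) fun x => g x μ ν)
    (hgsym : ∀ x μ ν, g x μ ν = g x ν μ)
    (hcompat : ∀ x α μ ν, pd (fun y => g y μ ν) α x
        = ∑ κ, Γ x κ α μ * g x κ ν + ∑ κ, Γ x κ α ν * g x μ κ)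
    (F : ℝ → ℝ → Pt) (hF : SmoothFam F)
    (hgeo : ∀ τ l μ, deriv (fun s => dlam F τ s μ) l
        + ∑ α, ∑ β, Γ (F τ l) μ α β * dlam F τ l α * dlam F τ l β = 0)
    (uhat : ℝ → ℝ → Pt) (huhat : SmoothFam uhat)
    (hpar : ∀ τ l μ, covLam Γ F uhat τ l μ = 0) :
    ∀ τ l,
      deriv (fun s => ∑ μ, ∑ ν, g (F τ s) μ ν * dlam F τ s μ * covTau Γ F uhat τ s ν) l
        = ∑ μ, ∑ κ, ∑ ν, ∑ α, ∑ β,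
            g (F τ l) μ κ * dlam F τ l μ * curv Γ (F τ l) κ ν α β
              * uhat τ l ν * dlam F τ l α * dtau F τ l β := by
  intro τ l
  set A := connForm Γ (F τ l) (dlam F τ l) with hA
  set K : Fin 4 → ℝ := fun κ =>
    ∑ ν, (∑ α, ∑ β, curv Γ (F τ l) κ ν α β * dlam F τ l α * dtau F τ l β) * uhat τ l ν with hK
  have hp : ∀ μ, HasDerivAt (fun s => dlam F τ s μ) (-∑ β, A μ β * dlam F τ l β) l := fun μ => by
    have h := hgeo τ l μ
    rw [sum_connForm_mul] at h
    rw [← eq_neg_of_add_eq_zero_left h]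
    exact hF.hasDerivAt_dlam_lam τ l μ
  have hg : ∀ μ ν, HasDerivAt (fun s => g (F τ s) μ ν)
      (∑ κ, A κ μ * g (F τ l) κ ν + ∑ κ, A κ ν * g (F τ l) μ κ) l := fun μ ν => by
    refine (pd_chain ((hgs μ ν).differentiable (by simp)) (hF.hasDerivAt_lam τ l)).congr_deriv ?_
    simp only [hcompat, hA, connForm, Fin.sum_univ_four]
    ring
  have hW := hasDerivAt_covTau hΓs hF huhat hpar τ l
  have hmain := HasDerivAt.fun_sum fun μ (_ : μ ∈ Finset.univ) =>
    HasDerivAt.fun_sum fun ν (_ : ν ∈ Finset.univ) => ((hg μ ν).fun_mul (hp μ)).fun_mul (hW ν)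
  rw [hmain.deriv]
  trans ∑ μ, ∑ κ, g (F τ l) μ κ * dlam F τ l μ * K κ
  · change ∑ μ, ∑ ν, (_ * _ + _ * (K ν - _)) = _
    simp only [← hA]
    generalize covTau Γ F uhat τ l = W
    generalize g (F τ l) = G
    generalize dlam F τ l = p
    clear_value A K
    simp only [Fin.sum_univ_four]
    ring
  · simp only [hK, Finset.mul_sum, Finset.sum_mul]
    refine Finset.sum_congr rfl fun μ _ => Finset.sum_congr rfl fun κ _ =>
      Finset.sum_congr rfl fun ν _ => Finset.sum_congr rfl fun α _ =>
      Finset.sum_congr rfl fun β _ => by ring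
end
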